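/- arXiv:2202.05501 — 2 statements merged into one kernel-verified Lean document; each statement's English description precedes it below -/
import Mathlib

section
/- Let f : ℝⁿ → ℝ be convex and differentiable, T > 0, r < −3, and suppose X : [0,T] → ℝⁿ solves 0 = Ẍ + (r/(t−T))Ẋ + 2∇f(X) on [0,T) with X(0) = X₀, Ẋ(0) = 0, extended continuously with Ẋ(T) = 0 and lim_{t→T⁻} Ẋ(t)/(t−T) = −(2/(r+1))∇f(X(T)). Then ‖∇f(X(T))‖² ≤ 2(−1−r)( f(X₀) − f(X(T)) )/T². -/
open Filter MeasureTheory
open scoped RealInnerProductSpace Topology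

theorem ogmg_ode_gradient_rate_general_r
    {E : Type*} [NormedAddCommGroup E] [InnerProductSpace ℝ E] [CompleteSpace E]
    (f : E → ℝ) (g : E → E)
    (hgrad : ∀ x, HasGradientAt f (g x) x)
    (hconv : ∀ x y, 0 ≤ f x - f y - ⟪g y, x - y⟫)
    (T : ℝ) (hT : 0 < T) (r : ℝ) (hr : r < -3)
    (X X' X'' : ℝ → E)
    (hX' : ∀ t ∈ Set.Ico (0:ℝ) T, HasDerivAt X (X' t) t)
    (hX'' : ∀ t ∈ Set.Ico (0:ℝ) T, HasDerivAt X' (X'' t) t)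
    (hXc : ContinuousOn X (Set.Icc 0 T))
    (hODE : ∀ t ∈ Set.Ico (0:ℝ) T,
      X'' t + (r / (t - T)) • X' t + (2:ℝ) • g (X t) = 0)
    (X₀ : E) (hX0 : X 0 = X₀) (hXd0 : X' 0 = 0)
    (hXdT : Tendsto X' (𝓝[<] T) (𝓝 0))
    (hXdlim : Tendsto (fun t => (t - T)⁻¹ • X' t) (𝓝[<] T)
      (𝓝 (-((2 / (r + 1)) • g (X T))))) :
    ‖g (X T)‖ ^ 2 ≤ 2 * (-1 - r) * (f X₀ - f (X T)) / T ^ 2 := by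
  set xT := X T with hxT
  set U : ℝ → ℝ := fun t => ((t - T)^2)⁻¹ * (1/2 * ⟪X' t, X' t⟫ + 2 * (f (X t) - f xT))
    - 2 * ((t - T)^3)⁻¹ * ⟪X' t, X t - xT⟫ + (3 + r) * ((t - T)^4)⁻¹ * ⟪X t - xT, X t - xT⟫ with hU
  have hpw : ∀ (n : ℕ) (t : ℝ), t - T ≠ 0 → HasDerivAt (fun t : ℝ => ((t - T)^n)⁻¹)
      (-(n * (t - T)^(n-1)) / ((t - T)^n)^2) t := by
    intro n t ht
    have h := (((hasDerivAt_id t).sub_const T).pow n).inv (by simpa using pow_ne_zero n ht)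
    simp only [id, mul_one] at h
    exact h
  have hder : ∀ t ∈ Set.Ico (0:ℝ) T, ∃ d, HasDerivAt U d t ∧ d ≤ 0 := by
    intro t ht
    have hu : t - T < 0 := by linarith [ht.2]
    have hu0 : t - T ≠ 0 := hu.ne
    have h1 := hX' t ht
    have h2 := hX'' t ht
    have hW := h1.sub_const xT
    have hf : HasDerivAt (fun t => f (X t)) ⟪g (X t), X' t⟫ t := by
      have := (hgrad (X t)).hasFDerivAt.comp_hasDerivAt t h1
      simp only [InnerProductSpace.toDual_apply_apply] at this
      exact this
    have hd := ((((hpw 2 t hu0).mul (((h2.inner ℝ h2).const_mul (1/2)).add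
      ((hf.sub_const (f xT)).const_mul 2))).sub
      (((hpw 3 t hu0).const_mul 2).mul (h2.inner ℝ hW))).add
      (((hpw 4 t hu0).const_mul (3 + r)).mul (hW.inner ℝ hW)))
    refine ⟨_, hd, ?_⟩
    have hX2 : X'' t = -((r / (t - T)) • X' t) - (2:ℝ) • g (X t) := by
      have := hODE t ht
      rw [← sub_eq_zero, ← this]; abel
    have hc := hconv xT (X t)
    have hc' : f (X t) - f xT - ⟪g (X t), X t - xT⟫ ≤ 0 := by
      rw [← neg_sub (X t) xT, inner_neg_right] at hc; linarith
    rw [hX2]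
    have hs := real_inner_self_nonneg (x := X' t - (2/(t - T)) • (X t - xT))
    simp only [Pi.add_apply]
    clear hd hc
    generalize X t - xT = W at *
    generalize f (X t) - f xT = F at *
    generalize g (X t) = G at *
    generalize X' t = V at *
    generalize t - T = u at *
    simp only [inner_sub_left, inner_sub_right, inner_neg_left, inner_neg_right,
      real_inner_smul_left, real_inner_smul_right, real_inner_comm V W, real_inner_comm G V,
      real_inner_comm G W] at hs hc' ⊢
    have hu3 : 0 < -(u^3)⁻¹ := by
      rw [← inv_neg, inv_pos]
      have : 0 < (-u)^3 := pow_pos (by linarith) 3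
      nlinarith
    have p1 := mul_nonneg hu3.le (neg_nonneg.2 hc')
    have p2 := mul_nonneg (mul_nonneg hu3.le (by linarith : 0 ≤ -(3 + r))) hs
    refine le_of_eq_of_le ?_ (by linarith : -(4 * (-(u^3)⁻¹ * -(F - ⟪G, W⟫)))
      - (-(u^3)⁻¹ * -(3 + r)) * (⟪V, V⟫ - 2 / u * ⟪V, W⟫ - (2 / u * ⟪V, W⟫ - 2 / u * (2 / u * ⟪W, W⟫))) ≤ 0)
    norm_num
    field_simp
    ring
  have hanti : AntitoneOn U (Set.Ico 0 T) := by
    apply antitoneOn_of_deriv_nonpos (convex_Ico 0 T)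
    · intro t ht
      obtain ⟨d, hd, _⟩ := hder t ht
      exact hd.continuousAt.continuousWithinAt
    · intro t ht
      obtain ⟨d, hd, _⟩ := hder t (interior_subset ht)
      exact hd.differentiableAt.differentiableWithinAt
    · intro t ht
      obtain ⟨d, hd, h⟩ := hder t (interior_subset ht)
      rw [hd.deriv]; exact h
  set k : ℝ := -(2 / (r + 1)) with hk
  have hA : Tendsto (fun t => (t - T)⁻¹ • X' t) (𝓝[<] T) (𝓝 (k • g xT)) := by
    rw [hk, neg_smul]; exact hXdlim
  have hB : Tendsto (fun t => ((t - T)^2)⁻¹ • (X t - xT)) (𝓝[<] T) (𝓝 ((k/2) • g xT)) := by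
    rw [Metric.tendsto_nhds] at hA ⊢
    intro ε hε
    have h1 := hA (ε/2) (by positivity)
    rw [Filter.Eventually, mem_nhdsLT_iff_exists_Ioo_subset] at h1
    obtain ⟨l, hl, hsub⟩ := h1
    have : Set.Ioo (max l 0) T ∈ 𝓝[<] T := Ioo_mem_nhdsLT (max_lt hl hT)
    filter_upwards [this] with t ht
    have htl : l < t := lt_of_le_of_lt (le_max_left _ _) ht.1
    have ht0 : 0 < t := lt_of_le_of_lt (le_max_right _ _) ht.1
    have htT : t < T := ht.2
    have key := norm_image_sub_le_of_norm_deriv_right_le_segment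
      (f := fun τ => X τ - ((τ - T)^2) • ((k/2) • g xT))
      (f' := fun τ => X' τ - (2 * (τ - T)) • ((k/2) • g xT)) (a := t) (b := T)
      (C := ε/2 * (T - t)) ?_ ?_ ?_ T (Set.right_mem_Icc.2 htT.le)
    · simp only [sub_self, ne_eq, OfNat.ofNat_ne_zero, not_false_eq_true, zero_pow, zero_smul,
        sub_zero] at key
      have hu : 0 < (t - T)^2 := by have : t - T ≠ 0 := by linarith
                                    positivity
      rw [dist_eq_norm]
      have e : ((t - T)^2)⁻¹ • (X t - xT) - (k/2) • g xT
          = -(((t - T)^2)⁻¹ • (xT - (X t - ((t - T)^2) • ((k/2) • g xT)))) := by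
        rw [smul_sub, smul_sub, smul_sub, inv_smul_smul₀ hu.ne']; abel
      rw [e, norm_neg, norm_smul, norm_inv, Real.norm_of_nonneg hu.le, inv_mul_lt_iff₀ hu]
      nlinarith
    · apply ContinuousOn.sub
      · exact hXc.mono (Set.Icc_subset_Icc_left ht0.le)
      · fun_prop
    · intro τ hτ
      apply HasDerivAt.hasDerivWithinAt
      apply (hX' τ ⟨ht0.le.trans hτ.1, hτ.2⟩).sub
      have := (((hasDerivAt_id τ).sub_const T).pow 2).smul_const ((k/2) • g xT)
      simpa using this
    · intro τ hτ
      have h := hsub ⟨htl.trans_le hτ.1, hτ.2⟩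
      simp only [Set.mem_ofPred_eq, dist_eq_norm] at h
      have hτ' : τ - T < 0 := by linarith [hτ.2]
      have e : X' τ - (2 * (τ - T)) • ((k/2) • g xT)
          = (τ - T) • ((τ - T)⁻¹ • X' τ - k • g xT) := by
        rw [smul_sub, smul_inv_smul₀ hτ'.ne, smul_smul, smul_smul]; congr 2; ring
      rw [e, norm_smul, Real.norm_of_nonpos hτ'.le]
      nlinarith [hτ.1, norm_nonneg ((τ - T)⁻¹ • X' τ - k • g xT)]
  have hV := ((((hA.inner (𝕜 := ℝ) hA).const_mul (1/2)).add
    (((tendsto_const_nhds (x := g xT)).inner (𝕜 := ℝ) hB).const_mul 2)).sub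
    ((hA.inner (𝕜 := ℝ) hB).const_mul 2)).add ((hB.inner (𝕜 := ℝ) hB).const_mul (3 + r))
  have hle := le_of_tendsto (b := 2 * (f X₀ - f xT) / T^2) hV (by
    filter_upwards [Ioo_mem_nhdsLT hT] with t ht
    have hu : t - T < 0 := by linarith [ht.2]
    have hu0 : t - T ≠ 0 := hu.ne
    have h0 := hanti (Set.left_mem_Ico.2 hT) ⟨ht.1.le, ht.2⟩ ht.1.le
    have hU0 : U 0 ≤ 2 * (f X₀ - f xT) / T^2 := by
      simp only [hU, hX0, hXd0, inner_zero_left, zero_sub]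
      have : (3 + r) * ((-T)^4)⁻¹ * ⟪X₀ - xT, X₀ - xT⟫ ≤ 0 := by
        apply mul_nonpos_of_nonpos_of_nonneg _ real_inner_self_nonneg
        apply mul_nonpos_of_nonpos_of_nonneg (by linarith)
        rw [inv_nonneg]; positivity
      have e : ((-T)^2)⁻¹ * (1/2 * 0 + 2 * (f X₀ - f xT)) = 2 * (f X₀ - f xT) / T^2 := by
        field_simp; ring
      linarith
    refine le_trans ?_ (h0.trans hU0)
    have hc := hconv (X t) xT
    simp only [hU, real_inner_smul_left, real_inner_smul_right]
    have hi : 0 < ((t - T)^2)⁻¹ := by positivity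
    have := mul_nonneg hi.le hc
    have e3 : ((t - T)^3)⁻¹ = ((t-T)^2)⁻¹ * (t-T)⁻¹ := by field_simp
    have e4 : ((t - T)^4)⁻¹ = ((t-T)^2)⁻¹ * ((t-T)^2)⁻¹ := by field_simp
    have e2 : (t-T)⁻¹ * ((t-T)⁻¹ * ⟪X' t, X' t⟫) = ((t-T)^2)⁻¹ * ⟪X' t, X' t⟫ := by field_simp
    rw [e3, e4, e2]
    nlinarith)
  simp only [real_inner_smul_left, real_inner_smul_right] at hle
  simp only [real_inner_self_eq_norm_sq] at hle
  have hr1 : r + 1 < 0 := by linarith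
  have e : 1 / 2 * (k * (k * ‖g xT‖ ^ 2)) + 2 * (k / 2 * ‖g xT‖ ^ 2) -
      2 * (k * (k / 2 * ‖g xT‖ ^ 2)) + (3 + r) * (k / 2 * (k / 2 * ‖g xT‖ ^ 2))
      = ‖g xT‖ ^ 2 / (-1 - r) := by
    have : r + 1 ≠ 0 := hr1.ne
    have : -1 - r ≠ 0 := by linarith
    rw [hk]; field_simp; ring
  have hle' : ‖g xT‖ ^ 2 / (-1 - r) ≤ 2 * (f X₀ - f xT) / T^2 := by
    rw [← e]; linarith
  rw [div_le_iff₀ (by linarith)] at hle'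
  refine hle'.trans (le_of_eq (by ring))
end

section
/- Let f : ℝⁿ → ℝ be convex and L-smooth with minimizer X⋆, and let s ∈ (0, 2/L]. Define θ_k = k/2 and the iteration: x₀ = z₀ = X₀, x_k⁺ = x_k − (s/2)∇f(x_k), z_{k+1} = z_k − sθ_k ∇f(x_k), x_{k+1} = (θ_k²/θ_{k+1}²) x_k⁺ + (1 − θ_k²/θ_{k+1}²) z_{k+1}. Then for all k ≥ 1, f(x_k⁺) − f⋆ ≤ 2‖X₀ − X⋆‖²/(s k²). -/
open Filter MeasureTheory
open scoped RealInnerProductSpace Topology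

theorem aux_descent {E : Type*} [NormedAddCommGroup E] [InnerProductSpace ℝ E] [CompleteSpace E]
    (f : E → ℝ) (g : E → E) (hgrad : ∀ x, HasGradientAt f (g x) x)
    (L : ℝ) (hsmooth : ∀ x y, ‖g x - g y‖ ≤ L * ‖x - y‖) (x v : E) :
    f (x + v) ≤ f x + ⟪g x, v⟫ + L / 2 * ‖v‖ ^ 2 := by
  have hd : ∀ t : ℝ, HasDerivAt (fun t : ℝ => f (x + t • v) - t * ⟪g x, v⟫ - L / 2 * ‖v‖ ^ 2 * t ^ 2)
      (⟪g (x + t • v), v⟫ - ⟪g x, v⟫ - L / 2 * ‖v‖ ^ 2 * (2 * t)) t := by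
    intro t
    have h1 : HasDerivAt (fun t : ℝ => x + t • v) v t := by
      simpa using ((hasDerivAt_id t).smul_const v).const_add x
    have h2 := (hgrad (x + t • v)).hasFDerivAt.comp_hasDerivAt t h1
    have h3 : HasDerivAt (fun t : ℝ => t * ⟪g x, v⟫) ⟪g x, v⟫ t := by
      simpa using (hasDerivAt_id t).mul_const ⟪g x, v⟫
    have h4 : HasDerivAt (fun t : ℝ => L / 2 * ‖v‖ ^ 2 * t ^ 2) (L / 2 * ‖v‖ ^ 2 * (2 * t)) t := by
      simpa using (hasDerivAt_pow 2 t).const_mul (L / 2 * ‖v‖ ^ 2)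
    have h5 := (h2.sub h3).sub h4
    simp only [InnerProductSpace.toDual_apply_apply] at h5
    exact h5
  have ha : AntitoneOn (fun t : ℝ => f (x + t • v) - t * ⟪g x, v⟫ - L / 2 * ‖v‖ ^ 2 * t ^ 2)
      (Set.Ici 0) := by
    apply antitoneOn_of_deriv_nonpos (convex_Ici 0)
    · exact fun t _ => (hd t).continuousAt.continuousWithinAt
    · exact fun t _ => (hd t).differentiableAt.differentiableWithinAt
    · intro t ht
      rw [interior_Ici, Set.mem_Ioi] at ht
      rw [(hd t).deriv]
      have h1 := real_inner_le_norm (g (x + t • v) - g x) v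
      have h2 := hsmooth (x + t • v) x
      rw [add_sub_cancel_left, norm_smul, Real.norm_of_nonneg ht.le] at h2
      have h3 := mul_le_mul_of_nonneg_right h2 (norm_nonneg v)
      rw [inner_sub_left] at h1
      nlinarith
  have h := ha (Set.mem_Ici.2 le_rfl) (Set.mem_Ici.2 zero_le_one) zero_le_one
  simp at h
  linarith

theorem aux_coco {E : Type*} [NormedAddCommGroup E] [InnerProductSpace ℝ E] [CompleteSpace E]
    (f : E → ℝ) (g : E → E) (hgrad : ∀ x, HasGradientAt f (g x) x)
    (hconv : ∀ x y, 0 ≤ f x - f y - ⟪g y, x - y⟫)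
    (L : ℝ) (hsmooth : ∀ x y, ‖g x - g y‖ ≤ L * ‖x - y‖)
    (a : ℝ) (ha : 0 < a) (haL : a * L ≤ 1) (x y : E) :
    f x + ⟪g x, y - x⟫ + a / 2 * ‖g x - g y‖ ^ 2 ≤ f y := by
  have h1 := hconv (y + a • (g x - g y)) x
  have h2 := aux_descent f g hgrad L hsmooth y (a • (g x - g y))
  have h3 : ⟪g x, g x - g y⟫ - ⟪g y, g x - g y⟫ = ‖g x - g y‖ ^ 2 := by
    rw [← inner_sub_left, real_inner_self_eq_norm_sq]
  rw [show y + a • (g x - g y) - x = (y - x) + a • (g x - g y) by abel, inner_add_right,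
    inner_smul_right] at h1
  rw [inner_smul_right, norm_smul, Real.norm_of_nonneg ha.le] at h2
  have h4 : a * (a * L) * ‖g x - g y‖ ^ 2 ≤ a * 1 * ‖g x - g y‖ ^ 2 := by gcongr
  have h5 : a * (⟪g x, g x - g y⟫ - ⟪g y, g x - g y⟫) = a * ‖g x - g y‖ ^ 2 := by rw [h3]
  nlinarith

theorem symplectic_euler_agm_rate
    {E : Type*} [NormedAddCommGroup E] [InnerProductSpace ℝ E] [CompleteSpace E]
    (f : E → ℝ) (g : E → E)
    (hgrad : ∀ x, HasGradientAt f (g x) x)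
    (hconv : ∀ x y, 0 ≤ f x - f y - ⟪g y, x - y⟫)
    (L : ℝ) (hL : 0 < L)
    (hsmooth : ∀ x y, ‖g x - g y‖ ≤ L * ‖x - y‖)
    (Xs : E) (hmin : ∀ x, f Xs ≤ f x)
    (s : ℝ) (hs0 : 0 < s) (hsL : s ≤ 2 / L)
    (X₀ : E) (x z : ℕ → E)
    (hx0 : x 0 = X₀) (hz0 : z 0 = X₀)
    (hz : ∀ k : ℕ, z (k + 1) = z k - (s * ((k : ℝ) / 2)) • g (x k))
    (hx : ∀ k : ℕ, x (k + 1) =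
      (((k : ℝ) / 2) ^ 2 / (((k : ℝ) + 1) / 2) ^ 2) • (x k - (s / 2) • g (x k))
        + (1 - ((k : ℝ) / 2) ^ 2 / (((k : ℝ) + 1) / 2) ^ 2) • z (k + 1)) :
    ∀ k : ℕ, 1 ≤ k →
      f (x k - (s / 2) • g (x k)) - f Xs
        ≤ 2 * ‖X₀ - Xs‖ ^ 2 / (s * (k : ℝ) ^ 2) := by
  obtain ⟨a, rfl⟩ : ∃ a, s = 2 * a := ⟨s / 2, by ring⟩
  have ha : 0 < a := by linarith
  have haL : a * L ≤ 1 := by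
    rw [le_div_iff₀ hL] at hsL
    linarith
  have h2a : 2 * a / 2 = a := by ring
  simp only [h2a] at hx ⊢
  have hco := aux_coco f g hgrad hconv L hsmooth a ha haL
  have hgs : g Xs = 0 := by
    have h := aux_descent f g hgrad L hsmooth Xs (-(a • g Xs))
    have h' := hmin (Xs + -(a • g Xs))
    rw [inner_neg_right, inner_smul_right, real_inner_self_eq_norm_sq, norm_neg, norm_smul,
      Real.norm_of_nonneg ha.le] at h
    have h4 : a * (a * L) * ‖g Xs‖ ^ 2 ≤ a * 1 * ‖g Xs‖ ^ 2 := by gcongr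
    have h5 : a * ‖g Xs‖ ^ 2 ≤ 0 := by nlinarith
    have h6 : ‖g Xs‖ ^ 2 ≤ 0 := by
      by_contra hc
      push Not at hc
      nlinarith [mul_pos ha hc]
    have h7 : ‖g Xs‖ = 0 := by nlinarith [norm_nonneg (g Xs)]
    exact norm_eq_zero.1 h7
  have hplus : ∀ y, f (y - a • g y) ≤ f y - a / 2 * ‖g y‖ ^ 2 := by
    intro y
    have h := aux_descent f g hgrad L hsmooth y (-(a • g y))
    rw [inner_neg_right, inner_smul_right, real_inner_self_eq_norm_sq, norm_neg, norm_smul,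
      Real.norm_of_nonneg ha.le, ← sub_eq_add_neg] at h
    have h4 : a * (a * L) * ‖g y‖ ^ 2 ≤ a * 1 * ‖g y‖ ^ 2 := by gcongr
    nlinarith
  have hF : ∀ y, 0 ≤ f y - a / 2 * ‖g y‖ ^ 2 - f Xs := by
    intro y
    linarith [hplus y, hmin (y - a • g y)]
  have key : ∀ k : ℕ, a * ((k : ℝ) ^ 2 + (k : ℝ) ^ 2 / (2 * k + 1)) *
      (f (x k) - a / 2 * ‖g (x k)‖ ^ 2 - f Xs) + ‖z (k + 1) - Xs‖ ^ 2 ≤ ‖X₀ - Xs‖ ^ 2 := by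
    intro k
    induction k with
    | zero => simp [hz 0, hz0]
    | succ k ih =>
      refine le_trans ?_ ih
      have hk : (0 : ℝ) ≤ k := Nat.cast_nonneg k
      have I1 := hco (x (k + 1)) (x k)
      have I2 := hco (x (k + 1)) Xs
      rw [hgs, sub_zero, inner_sub_right] at I2
      rw [@norm_sub_sq_real, inner_sub_right] at I1
      have hX : ((k : ℝ) + 1) ^ 2 * ⟪g (x (k + 1)), x (k + 1)⟫ =
          (k : ℝ) ^ 2 * (⟪g (x (k + 1)), x k⟫ - a * ⟪g (x (k + 1)), g (x k)⟫)
          + (2 * k + 1) * ⟪g (x (k + 1)), z (k + 1)⟫ := by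
        have h := congrArg (fun u => ⟪g (x (k + 1)), u⟫) (hx k)
        simp only [inner_add_right, inner_sub_right, inner_smul_right] at h
        rw [h]
        field_simp
        ring
      have hZ : ‖z (k + 1 + 1) - Xs‖ ^ 2 = ‖z (k + 1) - Xs‖ ^ 2
          - 2 * a * (k + 1) * (⟪g (x (k + 1)), z (k + 1)⟫ - ⟪g (x (k + 1)), Xs⟫)
          + a ^ 2 * (k + 1) ^ 2 * ‖g (x (k + 1))‖ ^ 2 := by
        rw [hz (k + 1), sub_right_comm, @norm_sub_sq_real, inner_smul_right, norm_smul,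
          real_inner_comm, inner_sub_right, mul_pow, Real.norm_eq_abs, sq_abs]
        push_cast
        ring
      rw [hZ]
      have hF1 := hF (x (k + 1))
      push_cast
      have hG : 0 ≤ ‖g (x (k + 1))‖ ^ 2 := by positivity
      generalize ‖g (x (k + 1))‖ ^ 2 = G at *
      generalize ‖g (x k)‖ ^ 2 = Gk at *
      generalize ⟪g (x (k + 1)), x (k + 1)⟫ = Xx at *
      generalize ⟪g (x (k + 1)), x k⟫ = P at *
      generalize ⟪g (x (k + 1)), g (x k)⟫ = Q at *
      generalize ⟪g (x (k + 1)), z (k + 1)⟫ = W at *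
      generalize ⟪g (x (k + 1)), Xs⟫ = S at *
      generalize ‖z (k + 1) - Xs‖ ^ 2 = N at *
      generalize (k : ℝ) = t at *
      obtain ⟨r, hr⟩ : ∃ r, r = t ^ 2 / (2 * t + 1) := ⟨_, rfl⟩
      have hr0 : 0 ≤ r := by rw [hr]; positivity
      have hrt : (2 * t + 1) * r = t ^ 2 := by rw [hr]; field_simp
      have hr' : (t + 1) ^ 2 / (2 * (t + 1) + 1) ≤ 1 + r := by
        rw [hr, div_le_iff₀ (by positivity)]
        have : (1 + t ^ 2 / (2 * t + 1)) * (2 * (t + 1) + 1)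
            = (t + 1) ^ 2 * (2 * t + 3) / (2 * t + 1) := by field_simp; ring
        rw [this, le_div_iff₀ (by positivity)]
        gcongr
        linarith
      rw [← hr]
      have J1 : (f (x (k + 1)) - a / 2 * G - f Xs) + (P - a * Q - Xx) + a * G
          ≤ f (x k) - a / 2 * Gk - f Xs := by linarith
      have J2 : (f (x (k + 1)) - a / 2 * G - f Xs) + a * G + S - Xx ≤ 0 := by linarith
      generalize f (x (k + 1)) - a / 2 * G - f Xs = F at *
      generalize f (x k) - a / 2 * Gk - f Xs = Fk at *
      have hrP : r * (P - a * Q - Xx) = Xx - W := by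
        have h : (2 * t + 1) * (r * (P - a * Q - Xx)) = (2 * t + 1) * (Xx - W) := by
          rw [← mul_assoc, hrt]; linarith
        exact mul_left_cancel₀ (by positivity) h
      have K1 := mul_le_mul_of_nonneg_left J1 (show 0 ≤ t ^ 2 + r by positivity)
      have K2 := mul_le_mul_of_nonneg_left J2 (show 0 ≤ 2 * (t + 1) by positivity)
      have hP2 : (t ^ 2 + r) * (P - a * Q - Xx) = 2 * (t + 1) * (Xx - W) := by
        rw [← hrP, ← hrt]; ring
      have K3 : (t ^ 2 + r + 2 * (t + 1)) * (F + a * G) + 2 * (t + 1) * (S - W)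
          ≤ (t ^ 2 + r) * Fk := by linarith
      have K4 : ((t + 1) ^ 2 + (t + 1) ^ 2 / (2 * (t + 1) + 1)) * F
          ≤ (t ^ 2 + r + 2 * (t + 1)) * F :=
        mul_le_mul_of_nonneg_right (by linarith) hF1
      have K5 : (t + 1) ^ 2 * (a * G) ≤ (t ^ 2 + r + 2 * (t + 1)) * (a * G) :=
        mul_le_mul_of_nonneg_right (by linarith) (by positivity)
      have K6 : ((t + 1) ^ 2 + (t + 1) ^ 2 / (2 * (t + 1) + 1)) * F + (t + 1) ^ 2 * (a * G)
          + 2 * (t + 1) * (S - W) ≤ (t ^ 2 + r) * Fk := by linarith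
      have K7 := mul_le_mul_of_nonneg_left K6 ha.le
      linarith
  intro k hk
  have hk' : (0 : ℝ) < k := by exact_mod_cast hk
  rw [le_div_iff₀ (by positivity)]
  have h1 := key k
  have h2 := hplus (x k)
  have h3 : a * (k : ℝ) ^ 2 * (f (x k) - a / 2 * ‖g (x k)‖ ^ 2 - f Xs)
      ≤ a * ((k : ℝ) ^ 2 + (k : ℝ) ^ 2 / (2 * k + 1)) *
      (f (x k) - a / 2 * ‖g (x k)‖ ^ 2 - f Xs) := by
    apply mul_le_mul_of_nonneg_right _ (hF _)
    apply mul_le_mul_of_nonneg_left _ ha.le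
    have : 0 ≤ (k : ℝ) ^ 2 / (2 * k + 1) := by positivity
    linarith
  have h4 : a * (k : ℝ) ^ 2 * (f (x k - a • g (x k)) - f Xs)
      ≤ a * (k : ℝ) ^ 2 * (f (x k) - a / 2 * ‖g (x k)‖ ^ 2 - f Xs) :=
    mul_le_mul_of_nonneg_left (by linarith) (by positivity)
  have h5 : 0 ≤ ‖z (k + 1) - Xs‖ ^ 2 := by positivity
  linarith
end
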